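/- For every c_1 > 0 there exist c_9 > 0 and C > 0 such that the following holds for all x ≥ 3: if α is a real number and a, q are integers with gcd(a, q) = 1, |α − a/q| ≤ 1/(48 x^3 q), and (log x)^{c_1} < q ≤ 48 x^3, then | Σ_{n ≤ x} e(−α n^4) | ≤ C x (log x)^{-c_9}. -/

import Mathlib

open Finset

/-- `ee θ = e(θ) = exp(2πiθ)`. -/
noncomputable def ee (θ : ℝ) : ℂ := Complex.exp (2 * Real.pi * Complex.I * θ)

lemma ee_add (a b : ℝ) : ee (a + b) = ee a * ee b := by
  unfold ee; rw [← Complex.exp_add]; congr 1; push_cast; ring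

lemma ee_norm (a : ℝ) : ‖ee a‖ = 1 := by
  unfold ee
  rw [show 2 * (Real.pi : ℂ) * Complex.I * (a : ℂ) = ((2 * Real.pi * a : ℝ) : ℂ) * Complex.I by
    push_cast; ring]
  exact Complex.norm_exp_ofReal_mul_I _

lemma ee_conj (a : ℝ) : (starRingEnd ℂ) (ee a) = ee (-a) := by
  unfold ee
  rw [← Complex.exp_conj]
  congr 1
  simp only [map_mul, Complex.conj_ofReal, Complex.conj_I, Complex.ofReal_neg, map_ofNat]
  ring

lemma ee_sub (a b : ℝ) : ee (a - b) = ee a * (starRingEnd ℂ) (ee b) := by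
  rw [ee_conj, ← ee_add, sub_eq_add_neg]

/-- exponential sum over an integer interval -/
noncomputable def SS (φ : ℤ → ℝ) (A B : ℤ) : ℂ := ∑ n ∈ Ico A B, ee (φ n)

lemma shift_sum (A B N : ℤ) (hN : B - A ≤ N) (n : ℤ) (hn : n ∈ Ico A B) (g : ℤ → ℂ) :
    ∑ m ∈ Ico A B, g m
      = ∑ h ∈ Ioo (-N) N, if n + h ∈ Ico A B then g (n + h) else 0 := by
  rw [← Finset.sum_filter]
  rw [mem_Ico] at hn
  refine Finset.sum_nbij' (fun m => m - n) (fun h => n + h) ?_ ?_ ?_ ?_ ?_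
  · intro m hm
    simp only [mem_Ico, mem_filter, mem_Ioo] at *
    omega
  · intro m hm
    simp only [mem_Ico, mem_filter, mem_Ioo] at *
    omega
  · intro m _; simp
  · intro m _; simp
  · intro m _; simp

lemma weyl_sq (A B N : ℤ) (hN : B - A ≤ N) (φ : ℤ → ℝ) (G : ℤ → ℝ)
    (hG : ∀ h ∈ Ioo (-N) N, ∀ A' B' : ℤ, B' - A' ≤ N →
      ‖SS (fun n => φ (n + h) - φ n) A' B'‖ ≤ G h) :
    ‖SS φ A B‖ ^ 2 ≤ ∑ h ∈ Ioo (-N) N, G h := by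
  have key : ((‖SS φ A B‖ ^ 2 : ℝ) : ℂ)
      = ∑ h ∈ Ioo (-N) N,
        SS (fun n => φ (n + h) - φ n) (max A (A - h)) (min B (B - h)) := by
    rw [show ((‖SS φ A B‖ ^ 2 : ℝ) : ℂ) = SS φ A B * (starRingEnd ℂ) (SS φ A B) by
      rw [Complex.mul_conj, Complex.normSq_eq_norm_sq]]
    unfold SS
    rw [map_sum, Finset.mul_sum]
    have h1 : ∀ n ∈ Ico A B, (∑ i ∈ Ico A B, ee (φ i)) * (starRingEnd ℂ) (ee (φ n))
        = ∑ h ∈ Ioo (-N) N, if n + h ∈ Ico A B then ee (φ (n + h) - φ n) else 0 := by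
      intro n hn
      rw [Finset.sum_mul, shift_sum A B N hN n hn]
      refine Finset.sum_congr rfl fun h _ => ?_
      rw [ee_sub]
    rw [Finset.sum_congr rfl h1, Finset.sum_comm]
    refine Finset.sum_congr rfl fun h _ => ?_
    rw [← Finset.sum_filter]
    refine Finset.sum_congr ?_ fun _ _ => rfl
    ext n
    simp only [mem_filter, mem_Ico]
    omega
  have h2 : ‖SS φ A B‖ ^ 2 = ‖((‖SS φ A B‖ ^ 2 : ℝ) : ℂ)‖ := by
    rw [Complex.norm_real, Real.norm_of_nonneg (by positivity)]
  rw [h2, key]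
  refine (norm_sum_le _ _).trans (Finset.sum_le_sum fun h hh => hG h hh _ _ ?_)
  omega

lemma sq_sum_Ioo (N : ℤ) (hN : 1 ≤ N) (G : ℤ → ℝ) :
    (∑ h ∈ Ioo (-N) N, G h) ^ 2 ≤ 2 * N * ∑ h ∈ Ioo (-N) N, G h ^ 2 := by
  refine (sq_sum_le_card_mul_sum_sq).trans ?_
  refine mul_le_mul_of_nonneg_right ?_ (Finset.sum_nonneg fun _ _ => by positivity)
  rw [Int.card_Ioo]
  have : ((N - -N - 1).toNat : ℤ) ≤ 2 * N := by omega
  exact_mod_cast this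

lemma weyl8 (A B N : ℤ) (hN1 : 1 ≤ N) (hN : B - A ≤ N) (φ : ℤ → ℝ) (G : ℤ → ℤ → ℤ → ℝ)
    (hG : ∀ h₁ ∈ Ioo (-N) N, ∀ h₂ ∈ Ioo (-N) N, ∀ h₃ ∈ Ioo (-N) N,
      ∀ A' B' : ℤ, B' - A' ≤ N →
      ‖SS (fun n => ((φ (n + h₃ + h₂ + h₁) - φ (n + h₃ + h₂)) - (φ (n + h₃ + h₁) - φ (n + h₃)))
        - ((φ (n + h₂ + h₁) - φ (n + h₂)) - (φ (n + h₁) - φ n))) A' B'‖ ≤ G h₁ h₂ h₃) :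
    ‖SS φ A B‖ ^ 8 ≤ (2 * N) ^ 4 *
      ∑ h₁ ∈ Ioo (-N) N, ∑ h₂ ∈ Ioo (-N) N, ∑ h₃ ∈ Ioo (-N) N, G h₁ h₂ h₃ := by
  have hN0 : (0 : ℝ) ≤ 2 * N := by
    have : (1 : ℝ) ≤ N := by exact_mod_cast hN1
    linarith
  set G2 : ℤ → ℤ → ℝ := fun h₁ h₂ => √(∑ h₃ ∈ Ioo (-N) N, G h₁ h₂ h₃) with hG2
  set G1 : ℤ → ℝ := fun h₁ => √(∑ h₂ ∈ Ioo (-N) N, G2 h₁ h₂) with hG1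
  have e2 : ∀ h₁ ∈ Ioo (-N) N, ∀ h₂ ∈ Ioo (-N) N, G2 h₁ h₂ ^ 2 = ∑ h₃ ∈ Ioo (-N) N, G h₁ h₂ h₃ := by
    intro h₁ hh₁ h₂ hh₂
    refine Real.sq_sqrt (Finset.sum_nonneg fun h₃ hh₃ => ?_)
    exact (norm_nonneg _).trans (hG h₁ hh₁ h₂ hh₂ h₃ hh₃ 0 0 (by omega))
  have e1 : ∀ h₁, G1 h₁ ^ 2 = ∑ h₂ ∈ Ioo (-N) N, G2 h₁ h₂ := by
    intro h₁
    exact Real.sq_sqrt (Finset.sum_nonneg fun h₂ _ => Real.sqrt_nonneg _)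
  have s1 : ‖SS φ A B‖ ^ 2 ≤ ∑ h ∈ Ioo (-N) N, G1 h := by
    refine weyl_sq A B N hN φ G1 fun h₁ hh₁ A₁ B₁ hA₁ => Real.le_sqrt_of_sq_le ?_
    refine weyl_sq A₁ B₁ N hA₁ _ _ fun h₂ hh₂ A₂ B₂ hA₂ => Real.le_sqrt_of_sq_le ?_
    exact weyl_sq A₂ B₂ N hA₂ _ _ fun h₃ hh₃ A₃ B₃ hA₃ => hG h₁ hh₁ h₂ hh₂ h₃ hh₃ A₃ B₃ hA₃
  have s2 : ‖SS φ A B‖ ^ 4 ≤ 2 * N * ∑ h₁ ∈ Ioo (-N) N, ∑ h₂ ∈ Ioo (-N) N, G2 h₁ h₂ := by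
    calc ‖SS φ A B‖ ^ 4 = (‖SS φ A B‖ ^ 2) ^ 2 := by ring
      _ ≤ (∑ h ∈ Ioo (-N) N, G1 h) ^ 2 := by gcongr
      _ ≤ _ := sq_sum_Ioo N hN1 _
      _ = _ := by simp_rw [e1]
  calc ‖SS φ A B‖ ^ 8 = (‖SS φ A B‖ ^ 4) ^ 2 := by ring
    _ ≤ (2 * N * ∑ h₁ ∈ Ioo (-N) N, ∑ h₂ ∈ Ioo (-N) N, G2 h₁ h₂) ^ 2 := by gcongr
    _ = (2 * N) ^ 2 * (∑ h₁ ∈ Ioo (-N) N, ∑ h₂ ∈ Ioo (-N) N, G2 h₁ h₂) ^ 2 := by ring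
    _ ≤ (2 * N) ^ 2 * (2 * N * ∑ h₁ ∈ Ioo (-N) N, (∑ h₂ ∈ Ioo (-N) N, G2 h₁ h₂) ^ 2) := by
        gcongr; exact sq_sum_Ioo N hN1 _
    _ ≤ (2 * N) ^ 2 * (2 * N * ∑ h₁ ∈ Ioo (-N) N, (2 * N * ∑ h₂ ∈ Ioo (-N) N, G2 h₁ h₂ ^ 2)) := by
        gcongr with h₁ _; exact sq_sum_Ioo N hN1 _
    _ = (2 * N) ^ 4 * ∑ h₁ ∈ Ioo (-N) N, ∑ h₂ ∈ Ioo (-N) N, G2 h₁ h₂ ^ 2 := by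
        rw [← Finset.mul_sum]; ring
    _ = _ := by
        congr 1
        exact Finset.sum_congr rfl fun h₁ hh₁ => Finset.sum_congr rfl fun h₂ hh₂ => e2 h₁ hh₁ h₂ hh₂

/-- Geometric sum, trivial bound -/
lemma SS_trivial (φ : ℤ → ℝ) (A B N : ℤ) (h0 : 0 ≤ N) (hN : B - A ≤ N) : ‖SS φ A B‖ ≤ N := by
  unfold SS
  refine (norm_sum_le _ _).trans ?_
  simp only [ee_norm, sum_const, Int.card_Ico, nsmul_eq_mul, mul_one]
  have : ((B - A).toNat : ℤ) ≤ N := by omega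
  exact_mod_cast this

lemma SS_geom (β c : ℝ) (A B : ℤ) :
    ‖SS (fun n => β * n + c) A B‖ * ‖ee β - 1‖ ≤ 2 := by
  have tele : ∀ k : ℕ, SS (fun n => β * n + c) A (A + k) * (ee β - 1)
      = ee (β * (A + k : ℤ) + c) - ee (β * A + c) := by
    intro k
    induction k with
    | zero => simp [SS]
    | succ k ih =>
      have : SS (fun n => β * n + c) A (A + (k + 1 : ℕ))
          = SS (fun n => β * n + c) A (A + k) + ee (β * (A + k : ℤ) + c) := by
        unfold SS
        have : Ico A (A + ((k + 1 : ℕ) : ℤ)) = insert (A + (k : ℤ)) (Ico A (A + (k : ℤ))) := by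
          ext n; simp only [mem_Ico, mem_insert]; push_cast; omega
        rw [this, Finset.sum_insert (by simp)]
        ring
      rw [this, add_mul, ih]
      have : ee (β * (A + (k + 1 : ℕ) : ℤ) + c) = ee (β * (A + k : ℤ) + c) * ee β := by
        rw [← ee_add]; congr 1; push_cast; ring
      rw [this]; ring
  by_cases h : A ≤ B
  · obtain ⟨k, hk⟩ := Int.eq_ofNat_of_zero_le (sub_nonneg.mpr h)
    have hB : B = A + k := by omega
    rw [← norm_mul, hB, tele]
    refine (norm_sub_le _ _).trans ?_
    rw [ee_norm, ee_norm]; norm_num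
  · simp [SS, Finset.Ico_eq_empty (show ¬ A < B by omega)]

lemma ee_sub_one_norm (β : ℝ) : 4 * ‖(β : UnitAddCircle)‖ ≤ ‖ee β - 1‖ := by
  rw [UnitAddCircle.norm_eq]
  set t := β - round β with ht
  have hee : ee β = ee t := by
    have : β = t + round β := by rw [ht]; ring
    conv_lhs => rw [this]
    rw [ee_add]
    have : ee ((round β : ℤ) : ℝ) = 1 := by
      unfold ee
      rw [Complex.exp_eq_one_iff]
      exact ⟨round β, by push_cast; ring⟩
    rw [this, mul_one]
  rw [hee]
  have habs : |t| ≤ 1 / 2 := abs_sub_round β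
  have h1 : ‖ee t - 1‖ = ‖2 * Real.sin (Real.pi * t)‖ := by
    have := Complex.norm_exp_I_mul_ofReal_sub_one (2 * Real.pi * t)
    rw [show 2 * Real.pi * t / 2 = Real.pi * t by ring] at this
    rw [← this]
    unfold ee
    congr 3
    push_cast; ring
  rw [h1, norm_mul, Real.norm_eq_abs, Real.norm_eq_abs, abs_two]
  have h2 : |Real.sin (Real.pi * t)| = Real.sin (Real.pi * |t|) := by
    have hpos := Real.pi_pos
    rcases le_total 0 t with h | h
    · rw [abs_of_nonneg h, abs_of_nonneg]
      rw [abs_of_nonneg h] at habs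
      exact Real.sin_nonneg_of_nonneg_of_le_pi (by positivity) (by nlinarith)
    · rw [abs_of_nonpos h] at habs
      rw [abs_of_nonpos h, mul_neg, Real.sin_neg, abs_of_nonpos]
      exact Real.sin_nonpos_of_nonpos_of_neg_pi_le (by nlinarith) (by nlinarith)
  rw [h2]
  have := Real.mul_le_sin (x := Real.pi * |t|) (by positivity) (by nlinarith [Real.pi_pos])
  have e : 2 / Real.pi * (Real.pi * |t|) = 2 * |t| := by
    field_simp
  rw [e] at this
  linarith

/-- residue majorant -/
noncomputable def KK (N : ℝ) (q : ℕ) (r : ℤ) : ℝ :=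
  if r = 0 then N else (q : ℝ) / r + (q : ℝ) / (q - r)

lemma KK_nonneg (N : ℝ) (hN : 0 ≤ N) (q : ℕ) (r : ℤ) (h0 : 0 ≤ r) (h1 : r < q) :
    0 ≤ KK N q r := by
  unfold KK
  split_ifs with h
  · exact hN
  · have h1' : (r : ℝ) < q := by exact_mod_cast h1
    have h0' : (0 : ℝ) ≤ r := by exact_mod_cast h0
    have : (0 : ℝ) < q - r := by linarith
    positivity

lemma circle_lower (q : ℕ) (hq : 0 < q) (m : ℤ) (θ : ℝ) (hθ : |θ| ≤ 1 / (2 * q))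
    (hr : m % q ≠ 0) :
    min (((m % q : ℤ) : ℝ) / q) (1 - ((m % q : ℤ) : ℝ) / q) / 2
      ≤ ‖(((m : ℝ) / q + θ : ℝ) : UnitAddCircle)‖ := by
  rw [UnitAddCircle.norm_eq]
  set β := (m : ℝ) / q + θ with hβ
  set r := m % q with hrdef
  have hq' : (0 : ℝ) < q := by exact_mod_cast hq
  have hr0 : 0 ≤ r := Int.emod_nonneg _ (by omega)
  have hr1 : r < q := Int.emod_lt_of_pos _ (by omega)
  have hm : m = r + q * (m / q) := by rw [hrdef]; exact (Int.emod_add_mul_ediv m q).symm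
  have hmR : (m : ℝ) / q = (r : ℝ) / q + ((m / q : ℤ) : ℝ) := by
    have : (m : ℝ) = r + q * ((m / q : ℤ) : ℝ) := by exact_mod_cast hm
    rw [this]; field_simp
  set k : ℤ := round β - m / q with hk
  set u : ℝ := (r : ℝ) / q with hu
  have e : β - round β = (u - k) + θ := by
    have hβ2 : β = u + ((m / q : ℤ) : ℝ) + θ := by rw [hβ, hmR]
    rw [hk]; push_cast; linarith
  have hu1 : 1 / q ≤ u := by
    rw [hu]; gcongr
    have : 1 ≤ r := by omega
    exact_mod_cast this
  have hu2 : 1 / q ≤ 1 - u := by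
    rw [hu, le_sub_iff_add_le, ← add_div, div_le_one hq']
    have : 1 + r ≤ q := by omega
    exact_mod_cast this
  have hmin : min u (1 - u) ≤ |u - k| := by
    rcases le_or_gt k 0 with h | h
    · refine (min_le_left _ _).trans ?_
      have : (k : ℝ) ≤ 0 := by exact_mod_cast h
      exact le_trans (by linarith) (le_abs_self _)
    · refine (min_le_right _ _).trans ?_
      have : (1 : ℝ) ≤ k := by exact_mod_cast h
      exact le_trans (by linarith) (neg_le_abs _)
  have hmin2 : 1 / (q : ℝ) ≤ min u (1 - u) := le_min hu1 hu2
  have htri : |u - k| ≤ |(u - k) + θ| + |θ| := by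
    have := abs_sub ((u - k) + θ) θ
    simpa using this
  rw [e]
  have : (1 : ℝ) / (2 * q) = (1 / q) / 2 := by field_simp
  rw [this] at hθ
  linarith

lemma SS_KK (q : ℕ) (hq : 0 < q) (m : ℤ) (θ c : ℝ) (hθ : |θ| ≤ 1 / (2 * q)) (A B N : ℤ)
    (h0 : 0 ≤ N) (hN : B - A ≤ N) :
    ‖SS (fun n => ((m : ℝ) / q + θ) * n + c) A B‖ ≤ KK N q (m % q) := by
  unfold KK
  split_ifs with h
  · exact SS_trivial _ _ _ _ h0 hN
  · have h1 := SS_geom ((m : ℝ) / q + θ) c A B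
    have h2 := ee_sub_one_norm ((m : ℝ) / q + θ)
    have h3 := circle_lower q hq m θ hθ h
    have hq' : (0 : ℝ) < q := by exact_mod_cast hq
    set r := m % q with hrdef
    have hr0 : 0 < r := lt_of_le_of_ne (Int.emod_nonneg _ (by omega)) (Ne.symm h)
    have hr1 : r < q := Int.emod_lt_of_pos _ (by omega)
    have hr0' : (0 : ℝ) < r := by exact_mod_cast hr0
    have hr1' : (0 : ℝ) < q - r := by
      have : (r : ℝ) < q := by exact_mod_cast hr1
      linarith
    set S := ‖SS (fun n => ((m : ℝ) / q + θ) * n + c) A B‖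
    have hS : 0 ≤ S := norm_nonneg _
    have h4 : S * min ((r : ℝ) / q) (1 - (r : ℝ) / q) ≤ 1 := by nlinarith
    rcases min_choice ((r : ℝ) / q) (1 - (r : ℝ) / q) with h5 | h5
    · rw [h5] at h4
      have : S ≤ q / r := by
        rw [le_div_iff₀ hr0']
        rw [mul_div_assoc', div_le_one hq'] at h4
        exact h4
      have : 0 ≤ (q : ℝ) / (q - r) := by positivity
      linarith
    · rw [h5] at h4
      have : S ≤ q / (q - r) := by
        rw [le_div_iff₀ hr1']
        rw [one_sub_div hq'.ne', mul_div_assoc', div_le_one hq'] at h4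
        exact h4
      have : 0 ≤ (q : ℝ) / r := by positivity
      linarith

lemma weyl_main (x α : ℝ) (a : ℤ) (q : ℕ) (hx : 3 ≤ x) (hq : 0 < q)
    (hα : |α - (a : ℝ) / q| ≤ 1 / (48 * x ^ 3 * q)) (N : ℕ) (hN : N = ⌊x⌋₊) :
    ‖∑ n ∈ Finset.Icc 1 ⌊x⌋₊, ee (-(α * (n : ℝ) ^ 4))‖ ^ 8 ≤ (2 * N) ^ 4 *
      ∑ h₁ ∈ Ioo (-(N : ℤ)) N, ∑ h₂ ∈ Ioo (-(N : ℤ)) N, ∑ h₃ ∈ Ioo (-(N : ℤ)) N,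
        KK N q ((-a) * (24 * h₁ * h₂ * h₃) % q) := by
  have hq' : (0 : ℝ) < q := by exact_mod_cast hq
  have hN1 : 1 ≤ N := by
    rw [hN]; exact Nat.le_floor (by norm_num; linarith)
  have hNx : (N : ℝ) ≤ x := by rw [hN]; exact Nat.floor_le (by linarith)
  have hS : ∑ n ∈ Finset.Icc 1 ⌊x⌋₊, ee (-(α * (n : ℝ) ^ 4))
      = SS (fun n => -(α * (n : ℝ) ^ 4)) 1 (N + 1) := by
    unfold SS
    rw [← hN]
    refine Finset.sum_nbij' (fun n => (n : ℤ)) (fun n => n.toNat) ?_ ?_ ?_ ?_ ?_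
    · intro n hn; simp only [mem_Icc, mem_Ico] at *; omega
    · intro n hn; simp only [mem_Icc, mem_Ico] at *; omega
    · intro n hn; simp
    · intro n hn; simp only [mem_Ico] at *; omega
    · intro n hn; simp
  rw [hS]
  have := weyl8 1 (N + 1) N (by exact_mod_cast hN1) (by omega) (fun n => -(α * (n : ℝ) ^ 4))
    (fun h₁ h₂ h₃ => KK N q ((-a) * (24 * h₁ * h₂ * h₃) % q)) ?_
  · simpa using this
  · intro h₁ hh₁ h₂ hh₂ h₃ hh₃ A' B' hAB
    set θ : ℝ := -(24 * h₁ * h₂ * h₃) * (α - a / q) with hθ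
    have hab : ∀ h ∈ Ioo (-(N : ℤ)) N, |(h : ℝ)| ≤ x := by
      intro h hh
      rw [mem_Ioo] at hh
      have h1 : -(N : ℝ) < h := by exact_mod_cast hh.1
      have h2 : (h : ℝ) < N := by exact_mod_cast hh.2
      rw [abs_le]; constructor <;> linarith
    have hθb : |θ| ≤ 1 / (2 * q) := by
      rw [hθ, abs_mul, abs_neg, abs_mul, abs_mul, abs_mul]
      rw [show |(24 : ℝ)| = 24 by norm_num]
      calc 24 * |(h₁ : ℝ)| * |(h₂ : ℝ)| * |(h₃ : ℝ)| * |α - a / q|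
          ≤ 24 * x * x * x * (1 / (48 * x ^ 3 * q)) := by
            gcongr
            exacts [hab _ hh₁, hab _ hh₂, hab _ hh₃]
        _ = 1 / (2 * q) := by field_simp; norm_num
    have key := SS_KK q hq ((-a) * (24 * h₁ * h₂ * h₃)) θ
      (-α * (12 * h₁ ^ 2 * h₂ * h₃ + 12 * h₁ * h₂ ^ 2 * h₃ + 12 * h₁ * h₂ * h₃ ^ 2)) hθb A' B' N
      (by omega) hAB
    refine le_trans (le_of_eq ?_) (key.trans (le_of_eq ?_))
    · congr 2
      funext n
      rw [hθ]
      push_cast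
      field_simp
      ring
    · simp

lemma fiber_card (q : ℕ) (hq : 0 < q) (b : ℤ) (hb : Int.gcd b q = 1) (A B r : ℤ) (hAB : A ≤ B) :
    ((#{h ∈ Ico A B | b * h % q = r} : ℕ) : ℝ) ≤ ((B : ℝ) - A) / q + 1 := by
  have hq' : (0 : ℝ) < q := by exact_mod_cast hq
  have hABR : (A : ℝ) ≤ B := by exact_mod_cast hAB
  rcases Finset.eq_empty_or_nonempty {h ∈ Ico A B | b * h % q = r} with he | ⟨v, hv⟩
  · rw [he]
    have : 0 ≤ ((B : ℝ) - A) / q := div_nonneg (by linarith) hq'.le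
    simp; linarith
  · have hsub : {h ∈ Ico A B | b * h % q = r} ⊆ {h ∈ Ico A B | h ≡ v [ZMOD (q : ℤ)]} := by
      intro h hh
      simp only [mem_filter] at hh hv ⊢
      refine ⟨hh.1, ?_⟩
      have h1 : b * h ≡ b * v [ZMOD (q : ℤ)] := by
        show b * h % q = b * v % q
        rw [hh.2, hv.2]
      have := h1.cancel_left_div_gcd (by exact_mod_cast hq)
      rw [Int.gcd_comm] at hb
      simpa [hb] using this
    have h1 := Finset.card_le_card hsub
    have h2 := Int.Ico_filter_modEq_card A B (r := (q : ℤ)) (by exact_mod_cast hq) v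
    have h3 : (#{h ∈ Ico A B | h ≡ v [ZMOD (q : ℤ)]} : ℚ) ≤ ((B : ℚ) - A) / q + 1 := by
      have hqQ : (0 : ℚ) < q := by exact_mod_cast hq
      have hABQ : (A : ℚ) ≤ B := by exact_mod_cast hAB
      have : (#{h ∈ Ico A B | h ≡ v [ZMOD (q : ℤ)]} : ℚ)
        = ((max (⌈((B : ℚ) - v) / ((q : ℤ) : ℚ)⌉ - ⌈((A : ℚ) - v) / ((q : ℤ) : ℚ)⌉) 0 : ℤ) : ℚ) := by
        exact_mod_cast h2
      rw [this]
      push_cast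
      refine max_le ?_ ?_
      · have c1 := Int.ceil_lt_add_one (((B : ℚ) - v) / (q : ℚ))
        have c2 := Int.le_ceil (((A : ℚ) - v) / (q : ℚ))
        have : ((B : ℚ) - A) / q = ((B : ℚ) - v) / (q : ℚ) - ((A : ℚ) - v) / (q : ℚ) := by ring
        rw [this]; linarith
      · have : 0 ≤ ((B : ℚ) - A) / q := div_nonneg (by linarith) hqQ.le
        linarith
    have h3' : ((#{h ∈ Ico A B | h ≡ v [ZMOD (q : ℤ)]} : ℕ) : ℝ) ≤ ((B : ℝ) - A) / q + 1 := by
      exact_mod_cast h3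
    refine le_trans ?_ h3'
    exact_mod_cast h1

lemma KK_period (N : ℝ) (q : ℕ) (hq : 0 < q) :
    ∑ r ∈ Ico (0 : ℤ) q, KK N q r ≤ N + 2 * q * (1 + Real.log q) := by
  have e : ∑ r ∈ Ico (0 : ℤ) q, KK N q r = ∑ r ∈ range q, KK N q (r : ℤ) := by
    symm
    refine Finset.sum_nbij' (fun n => (n : ℤ)) (fun n => n.toNat) ?_ ?_ ?_ ?_ ?_
    · intro n hn; simp only [mem_range, mem_Ico] at *; omega
    · intro n hn; simp only [mem_range, mem_Ico] at *; omega
    · intro n hn; simp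
    · intro n hn; simp only [mem_Ico] at *; omega
    · intro n hn; simp
  rw [e]
  obtain ⟨k, rfl⟩ : ∃ k, q = k + 1 := ⟨q - 1, by omega⟩
  rw [Finset.sum_range_succ']
  have hk : ∀ i ∈ range k, KK N (k + 1) ((i + 1 : ℕ) : ℤ)
      = ((k + 1 : ℕ) : ℝ) * ((i : ℝ) + 1)⁻¹ + ((k + 1 : ℕ) : ℝ) * (((k - 1 - i : ℕ) : ℝ) + 1)⁻¹ := by
    intro i hi
    rw [mem_range] at hi
    unfold KK
    rw [if_neg (by omega)]
    have : (((k - 1 - i : ℕ) : ℝ) + 1) = (k : ℝ) - i := by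
      have : ((k - 1 - i : ℕ) : ℤ) + 1 = (k : ℤ) - i := by omega
      exact_mod_cast this
    rw [this, div_eq_mul_inv, div_eq_mul_inv]
    push_cast
    congr 3
    ring
  rw [Finset.sum_congr rfl hk, Finset.sum_add_distrib, ← Finset.mul_sum, ← Finset.mul_sum,
    Finset.sum_range_reflect (fun i : ℕ => ((i : ℝ) + 1)⁻¹)]
  have hh : ∑ i ∈ range k, ((i : ℝ) + 1)⁻¹ ≤ 1 + Real.log ((k + 1 : ℕ) : ℝ) := by
    have h1 := harmonic_le_one_add_log (k + 1)
    have h2 : ((harmonic (k + 1) : ℚ) : ℝ) = ∑ i ∈ range (k + 1), ((i : ℝ) + 1)⁻¹ := by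
      unfold harmonic; push_cast; rfl
    rw [h2, Finset.sum_range_succ] at h1
    have : 0 ≤ ((k : ℝ) + 1)⁻¹ := by positivity
    linarith
  have h0 : KK N (k + 1) ((0 : ℕ) : ℤ) = N := by simp [KK]
  rw [h0]
  have : (0 : ℝ) ≤ ((k + 1 : ℕ) : ℝ) := by positivity
  nlinarith

lemma KK_sum (N : ℝ) (hN : 0 ≤ N) (q : ℕ) (hq : 0 < q) (b : ℤ) (hb : Int.gcd b q = 1) (A B : ℤ)
    (hAB : A ≤ B) :
    ∑ h ∈ Ico A B, KK N q (b * h % q)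
      ≤ (((B : ℝ) - A) / q + 1) * (N + 2 * q * (1 + Real.log q)) := by
  have hq' : (0 : ℝ) < q := by exact_mod_cast hq
  have hABR : (A : ℝ) ≤ B := by exact_mod_cast hAB
  have hmap : ∀ h ∈ Ico A B, b * h % q ∈ Ico (0 : ℤ) q := by
    intro h _
    rw [mem_Ico]
    exact ⟨Int.emod_nonneg _ (by omega), Int.emod_lt_of_pos _ (by omega)⟩
  rw [← Finset.sum_fiberwise_of_maps_to hmap]
  calc ∑ r ∈ Ico (0 : ℤ) q, ∑ h ∈ Ico A B with b * h % q = r, KK N q (b * h % q)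
      = ∑ r ∈ Ico (0 : ℤ) q, (#{h ∈ Ico A B | b * h % q = r} : ℝ) * KK N q r := by
        refine Finset.sum_congr rfl fun r _ => ?_
        rw [← nsmul_eq_mul, ← Finset.sum_const]
        refine Finset.sum_congr rfl fun h hh => ?_
        rw [(mem_filter.mp hh).2]
    _ ≤ ∑ r ∈ Ico (0 : ℤ) q, (((B : ℝ) - A) / q + 1) * KK N q r := by
        refine Finset.sum_le_sum fun r hr => ?_
        rw [mem_Ico] at hr
        exact mul_le_mul_of_nonneg_right (fiber_card q hq b hb A B r hAB)
          (KK_nonneg N hN q r hr.1 hr.2)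
    _ = (((B : ℝ) - A) / q + 1) * ∑ r ∈ Ico (0 : ℤ) q, KK N q r := by rw [Finset.mul_sum]
    _ ≤ _ := by
        have : 0 ≤ ((B : ℝ) - A) / q := div_nonneg (by linarith) hq'.le
        exact mul_le_mul_of_nonneg_left (KK_period N q hq) (by linarith)

lemma pow_bound : ∃ K : ℝ, 1 ≤ K ∧ ∀ v : ℕ, ((v : ℝ) + 1) ^ 8 ≤ K * 2 ^ v := by
  have h := tendsto_pow_const_mul_const_pow_of_abs_lt_one 8 (r := (1 / 2 : ℝ))
    (by rw [abs_of_pos] <;> norm_num)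
  obtain ⟨M, hM⟩ := h.bddAbove_range
  refine ⟨max 1 (2 * M), le_max_left _ _, fun v => ?_⟩
  have h1 : ((v + 1 : ℕ) : ℝ) ^ 8 * (1 / 2) ^ (v + 1) ≤ M := hM ⟨v + 1, rfl⟩
  have h2 : ((v : ℝ) + 1) ^ 8 ≤ 2 * M * 2 ^ v := by
    push_cast at h1
    rw [one_div, inv_pow, ← div_eq_mul_inv, div_le_iff₀ (by positivity)] at h1
    rw [pow_succ 2 v] at h1
    linarith
  exact h2.trans (by gcongr; exact le_max_right _ _)

lemma divisor_bound : ∃ C : ℝ, 1 ≤ C ∧ ∀ n : ℕ, 0 < n →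
    ((#n.divisors : ℕ) : ℝ) ≤ C * (n : ℝ) ^ (1 / 8 : ℝ) := by
  obtain ⟨K, hK1, hK⟩ := pow_bound
  have main : ∀ n : ℕ, 0 < n → ((#n.divisors : ℕ) : ℝ) ^ 8 ≤ K ^ 256 * n := by
    intro n hn
    rw [Nat.card_divisors hn.ne']
    have hprod : (n : ℝ) = ∏ p ∈ n.primeFactors, (p : ℝ) ^ (n.factorization p) := by
      conv_lhs => rw [← Nat.prod_factorization_pow_eq_self hn.ne']
      rw [Finsupp.prod]
      push_cast
      rfl
    push_cast
    rw [← Finset.prod_pow]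
    have step : ∀ p ∈ n.primeFactors, ((n.factorization p : ℝ) + 1) ^ 8
        ≤ (if p < 256 then K else 1) * (p : ℝ) ^ (n.factorization p) := by
      intro p hp
      have hp2 : 2 ≤ p := (Nat.prime_of_mem_primeFactors hp).two_le
      split_ifs with hlt
      · refine (hK _).trans ?_
        gcongr
        exact_mod_cast hp2
      · rw [one_mul]
        have h256 : (256 : ℝ) ≤ p := by exact_mod_cast not_lt.mp hlt
        have hv : ((n.factorization p : ℝ) + 1) ≤ 2 ^ (n.factorization p) := by
          exact_mod_cast (Nat.lt_two_pow_self (n := n.factorization p))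
        calc ((n.factorization p : ℝ) + 1) ^ 8 ≤ (2 ^ (n.factorization p)) ^ 8 := by gcongr
          _ = 256 ^ (n.factorization p) := by rw [← pow_mul, mul_comm, pow_mul]; norm_num
          _ ≤ _ := by gcongr
    refine (Finset.prod_le_prod (fun p _ => by positivity) step).trans ?_
    rw [Finset.prod_mul_distrib, ← hprod]
    gcongr
    rw [← Finset.prod_filter, Finset.prod_const]
    refine pow_le_pow_right₀ hK1 ?_
    have : {p ∈ n.primeFactors | p < 256} ⊆ range 256 := by
      intro p hp; simp only [mem_filter, mem_range] at *; exact hp.2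
    simpa using Finset.card_le_card this
  refine ⟨(K ^ 256 : ℝ), one_le_pow₀ hK1, fun n hn => ?_⟩
  have hn' : (0 : ℝ) < n := by exact_mod_cast hn
  have h8 : ((n : ℝ) ^ (1 / 8 : ℝ)) ^ 8 = n := by
    rw [← Real.rpow_natCast, ← Real.rpow_mul hn'.le]; norm_num
  refine le_of_pow_le_pow_left₀ (n := 8) (by norm_num) (by positivity) ?_
  rw [mul_pow, h8]
  refine (main n hn).trans ?_
  gcongr
  exact le_self_pow₀ (one_le_pow₀ hK1) (by norm_num)

lemma Ioo_eq (N : ℕ) : Ioo (-(N : ℤ)) N = Ico (-(N : ℤ) + 1) N := by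
  ext h; simp only [mem_Ioo, mem_Ico]; omega

lemma card_Ioo_le (N : ℕ) : ((#(Ioo (-(N : ℤ)) N) : ℕ) : ℝ) ≤ 2 * N := by
  rw [Int.card_Ioo]
  have : ((N : ℤ) - -N - 1).toNat ≤ 2 * N := by omega
  exact_mod_cast this

lemma KK_scale (N : ℝ) (q d : ℕ) (hd : 0 < d) (m : ℤ) :
    KK N (d * q) ((d * m) % ((d * q : ℕ) : ℤ)) = KK N q (m % q) := by
  have hd' : (d : ℝ) ≠ 0 := by positivity
  push_cast
  rw [Int.mul_emod_mul_of_pos _ _ (by exact_mod_cast hd)]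
  unfold KK
  by_cases h : m % q = 0
  · simp [h]
  · rw [if_neg h, if_neg (mul_ne_zero (by positivity) h)]
    push_cast
    rw [← mul_sub, mul_div_mul_left _ _ hd', mul_div_mul_left _ _ hd']

lemma case1_inner (N q : ℕ) (hq : 0 < q) (hqN : q ≤ N) (a M : ℤ) (ha : Int.gcd a q = 1) :
    ∑ h ∈ Ioo (-(N : ℤ)) N, KK N q ((-a) * (M * h) % q)
      ≤ 3 * N ^ 2 * (Int.gcd M q : ℝ) / q + 6 * N * (1 + Real.log N) := by
  obtain ⟨d, hd⟩ : ∃ d, d = Int.gcd M q := ⟨_, rfl⟩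
  have hd0 : 0 < d := by
    rw [hd]; exact Int.gcd_pos_of_ne_zero_right _ (by omega)
  obtain ⟨M', hM'⟩ : (d : ℤ) ∣ M := by rw [hd]; exact Int.gcd_dvd_left _ _
  obtain ⟨q', hq'⟩ : d ∣ q := by
    have : (d : ℤ) ∣ q := by rw [hd]; exact Int.gcd_dvd_right _ _
    exact_mod_cast this
  have hcop : Int.gcd M' q' = 1 := by
    have h1 : Int.gcd (d * M') (d * q' : ℤ) = d * Int.gcd M' q' := by
      rw [Int.gcd_mul_left]; simp
    have h2 : Int.gcd (d * M') (d * q' : ℤ) = d := by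
      rw [← hM']; conv_rhs => rw [hd, hq']
      push_cast; rfl
    have : d * Int.gcd M' q' = d * 1 := by omega
    exact Nat.eq_of_mul_eq_mul_left hd0 this
  have hq'0 : 0 < q' := by
    rcases Nat.eq_zero_or_pos q' with h | h
    · subst h; omega
    · exact h
  have hcop2 : Int.gcd (-a * M') q' = 1 := by
    have haq : Int.gcd (-a) q' = 1 := by
      rw [Int.neg_gcd]
      refine Nat.dvd_one.mp (ha ▸ ?_)
      refine Int.dvd_gcd (Int.gcd_dvd_left _ _) ?_ |> fun h => by exact_mod_cast h
      refine (Int.gcd_dvd_right _ _).trans ?_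
      rw [hq']; push_cast; exact dvd_mul_left _ _
    rw [← Int.isCoprime_iff_gcd_eq_one] at *
    exact IsCoprime.mul_left haq hcop
  have e : ∀ h ∈ Ioo (-(N : ℤ)) N, KK N q ((-a) * (M * h) % q) = KK N q' ((-a * M') * h % q') := by
    intro h _
    rw [← KK_scale N q' d hd0, hq', hM']
    congr 2
    ring
  rw [Finset.sum_congr rfl e, Ioo_eq]
  have hN1 : 1 ≤ N := by omega
  refine (KK_sum N (by positivity) q' hq'0 _ hcop2 _ _ (by omega)).trans ?_
  rw [← hd]
  have hq'R : (0 : ℝ) < q' := by exact_mod_cast hq'0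
  have hdR : (0 : ℝ) < d := by exact_mod_cast hd0
  have hq'N : q' ≤ N := by
    refine le_trans ?_ hqN
    rw [hq']; exact Nat.le_mul_of_pos_left _ hd0
  have hq'NR : (q' : ℝ) ≤ N := by exact_mod_cast hq'N
  have hlog : Real.log q' ≤ Real.log N := Real.log_le_log hq'R hq'NR
  have hlog0 : 0 ≤ Real.log q' := Real.log_natCast_nonneg _
  have hdq : (d : ℝ) / q = 1 / q' := by
    rw [hq']; push_cast; field_simp
  have hN0 : (0 : ℝ) < N := by exact_mod_cast hN1
  calc (((((N : ℕ) : ℤ) : ℝ) - ((-(N : ℤ) + 1 : ℤ) : ℝ)) / q' + 1) * (N + 2 * q' * (1 + Real.log q'))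
      ≤ (3 * N / q') * (N + 2 * q' * (1 + Real.log N)) := by
        gcongr
        rw [div_add_one hq'R.ne']
        gcongr
        push_cast
        linarith
    _ = 3 * N ^ 2 * (1 / q') + 6 * N * (1 + Real.log N) := by field_simp; ring
    _ = _ := by rw [← hdq]; ring

lemma gcd_sum (N q : ℕ) (hq : 0 < q) (hqN : q ≤ N) :
    ∑ h ∈ Ioo (-(N : ℤ)) N, (Int.gcd h q : ℝ) ≤ 3 * N * (#q.divisors : ℝ) := by
  have h1 : ∀ h ∈ Ioo (-(N : ℤ)) N, (Int.gcd h q : ℝ)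
      ≤ ∑ d ∈ q.divisors, if (1 : ℤ) * h % d = 0 then (d : ℝ) else 0 := by
    intro h _
    have hmem : Int.gcd h q ∈ q.divisors := by
      rw [Nat.mem_divisors]
      refine ⟨?_, by omega⟩
      have := Int.gcd_dvd_right h (q : ℤ)
      exact_mod_cast this
    refine le_trans (le_of_eq ?_) (Finset.single_le_sum
      (f := fun d : ℕ => if (1 : ℤ) * h % d = 0 then (d : ℝ) else 0) (fun d _ => ?_) hmem)
    · have : (1 : ℤ) * h % (Int.gcd h q : ℤ) = 0 := by
        rw [one_mul]; exact Int.emod_eq_zero_of_dvd (Int.gcd_dvd_left _ _)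
      simp only [this, if_true]
    · show (0 : ℝ) ≤ if _ then _ else _
      split_ifs <;> positivity
  refine (Finset.sum_le_sum h1).trans ?_
  rw [Finset.sum_comm]
  have h2 : ∀ d ∈ q.divisors,
      ∑ h ∈ Ioo (-(N : ℤ)) N, (if (1 : ℤ) * h % d = 0 then (d : ℝ) else 0) ≤ 3 * N := by
    intro d hd
    have hd0 : 0 < d := Nat.pos_of_mem_divisors hd
    have hdN : d ≤ N := (Nat.divisor_le hd).trans hqN
    have hdR : (0 : ℝ) < d := by exact_mod_cast hd0
    have hdNR : (d : ℝ) ≤ N := by exact_mod_cast hdN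
    rw [← Finset.sum_filter, Finset.sum_const, nsmul_eq_mul, Ioo_eq]
    have := fiber_card d hd0 1 (by simp) (-(N : ℤ) + 1) N 0 (by omega)
    calc _ ≤ (((((N : ℕ) : ℤ) : ℝ) - ((-(N : ℤ) + 1 : ℤ) : ℝ)) / d + 1) * d := by gcongr
      _ = 2 * N - 1 + d := by push_cast; field_simp; ring
      _ ≤ 3 * N := by linarith
  refine (Finset.sum_le_sum h2).trans (le_of_eq ?_)
  rw [Finset.sum_const, nsmul_eq_mul]; ring

lemma gcd_mul_le (h₁ h₂ : ℤ) (q : ℕ) (hq : 0 < q) :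
    Int.gcd (24 * h₁ * h₂) q ≤ 24 * Int.gcd h₁ q * Int.gcd h₂ q := by
  have key : ∀ u v : ℤ, Int.gcd (u * v) q ≤ Int.gcd u q * Int.gcd v q := by
    intro u v
    refine Nat.le_of_dvd (Nat.mul_pos (Int.gcd_pos_of_ne_zero_right _ (by omega))
      (Int.gcd_pos_of_ne_zero_right _ (by omega))) ?_
    simp only [Int.gcd_def, Int.natAbs_mul]
    exact Nat.gcd_mul_left_dvd_mul_gcd _ _ _
  have h24 : Int.gcd 24 q ≤ 24 := Nat.le_of_dvd (by norm_num) (by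
    have := Int.gcd_dvd_left (24 : ℤ) (q : ℤ)
    exact_mod_cast this)
  calc _ ≤ _ := key _ _
    _ ≤ Int.gcd 24 q * Int.gcd h₁ q * Int.gcd h₂ q := Nat.mul_le_mul_right _ (key _ _)
    _ ≤ _ := by gcongr

lemma case1 (N q : ℕ) (hq : 0 < q) (hqN : q ≤ N) (a : ℤ) (ha : Int.gcd a q = 1) :
    ∑ h₁ ∈ Ioo (-(N : ℤ)) N, ∑ h₂ ∈ Ioo (-(N : ℤ)) N, ∑ h₃ ∈ Ioo (-(N : ℤ)) N,
        KK N q ((-a) * (24 * h₁ * h₂ * h₃) % q)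
      ≤ 648 * N ^ 4 * (#q.divisors : ℝ) ^ 2 / q + 24 * N ^ 3 * (1 + Real.log N) := by
  have hlog : 0 ≤ Real.log N := Real.log_natCast_nonneg _
  set I := Ioo (-(N : ℤ)) N with hI
  have hg : ∑ h ∈ I, (Int.gcd h q : ℝ) ≤ 3 * N * (#q.divisors : ℝ) := gcd_sum N q hq hqN
  have hc : (#I : ℝ) ≤ 2 * N := card_Ioo_le N
  set E := 6 * N * (1 + Real.log N) with hE
  have hE0 : 0 ≤ E := by positivity
  calc _ ≤ ∑ h₁ ∈ I, ∑ h₂ ∈ I, (3 * N ^ 2 * (Int.gcd (24 * h₁ * h₂) q : ℝ) / q + E) :=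
        Finset.sum_le_sum fun h₁ _ => Finset.sum_le_sum fun h₂ _ =>
          case1_inner N q hq hqN a (24 * h₁ * h₂) ha
    _ ≤ ∑ h₁ ∈ I, ∑ h₂ ∈ I, (3 * N ^ 2 * (24 * (Int.gcd h₁ q : ℝ) * (Int.gcd h₂ q : ℝ)) / q + E) := by
        refine Finset.sum_le_sum fun h₁ _ => Finset.sum_le_sum fun h₂ _ => ?_
        gcongr
        exact_mod_cast gcd_mul_le h₁ h₂ q hq
    _ = 72 * N ^ 2 / q * ((∑ h ∈ I, (Int.gcd h q : ℝ)) * ∑ h ∈ I, (Int.gcd h q : ℝ))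
        + (#I : ℝ) * (#I : ℝ) * E := by
        rw [Finset.sum_mul_sum, Finset.mul_sum]
        simp only [Finset.sum_add_distrib, Finset.sum_const, nsmul_eq_mul, Finset.mul_sum]
        congr 1
        · refine Finset.sum_congr rfl fun h₁ _ => Finset.sum_congr rfl fun h₂ _ => ?_
          ring
        · ring
    _ ≤ 72 * N ^ 2 / q * ((3 * N * (#q.divisors : ℝ)) * (3 * N * (#q.divisors : ℝ)))
        + (2 * N) * (2 * N) * E := by
        have : 0 ≤ ∑ h ∈ I, (Int.gcd h q : ℝ) := Finset.sum_nonneg fun _ _ => by positivity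
        gcongr
    _ = _ := by rw [hE]; ring

lemma int_div_card (I : Finset ℤ) (m : ℤ) (hm : m ≠ 0) :
    #{h ∈ I | h ∣ m} ≤ 2 * #(m.natAbs.divisors) := by
  have hsub : {h ∈ I | h ∣ m} ⊆ (m.natAbs.divisors).image (fun d : ℕ => (d : ℤ))
      ∪ (m.natAbs.divisors).image (fun d : ℕ => -(d : ℤ)) := by
    intro h hh
    rw [mem_filter] at hh
    have h1 : h.natAbs ∈ m.natAbs.divisors := by
      rw [Nat.mem_divisors]
      exact ⟨Int.natAbs_dvd_natAbs.mpr hh.2, by omega⟩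
    rw [mem_union, mem_image, mem_image]
    rcases le_total 0 h with h0 | h0
    · left; exact ⟨_, h1, by omega⟩
    · right; exact ⟨_, h1, by omega⟩
  refine (Finset.card_le_card hsub).trans ((Finset.card_union_le _ _).trans ?_)
  have := Finset.card_image_le (s := m.natAbs.divisors) (f := fun d : ℕ => (d : ℤ))
  have := Finset.card_image_le (s := m.natAbs.divisors) (f := fun d : ℕ => -(d : ℤ))
  omega

lemma triple_card (I : Finset ℤ) (m : ℤ) :
    #{t ∈ I ×ˢ I ×ˢ I | 24 * t.1 * t.2.1 * t.2.2 ≠ 0 ∧ 24 * t.1 * t.2.1 * t.2.2 = m}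
      ≤ (2 * #(m.natAbs.divisors)) ^ 2 := by
  by_cases hm : m = 0
  · subst hm
    rw [Finset.filter_false_of_mem]
    · simp
    · intro t _ h; exact h.1 h.2
  · have hle := int_div_card I m hm
    have : #{t ∈ I ×ˢ I ×ˢ I | 24 * t.1 * t.2.1 * t.2.2 ≠ 0 ∧ 24 * t.1 * t.2.1 * t.2.2 = m}
        ≤ #({h ∈ I | h ∣ m} ×ˢ {h ∈ I | h ∣ m}) := by
      refine Finset.card_le_card_of_injOn (fun t => (t.1, t.2.1)) ?_ ?_
      · rintro ⟨t1, t2, t3⟩ ht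
        simp only [coe_filter, mem_product, Set.mem_ofPred_eq, coe_product, Set.mem_prod] at ht ⊢
        refine ⟨⟨ht.1.1, ⟨24 * t2 * t3, ?_⟩⟩, ⟨ht.1.2.1, ⟨24 * t1 * t3, ?_⟩⟩⟩
        · rw [← ht.2.2]; ring
        · rw [← ht.2.2]; ring
      · rintro ⟨t1, t2, t3⟩ ht ⟨s1, s2, s3⟩ hs hst
        simp only [coe_filter, mem_product, Set.mem_ofPred_eq, Prod.mk.injEq] at ht hs hst ⊢
        obtain ⟨rfl, rfl⟩ := hst
        refine ⟨rfl, rfl, ?_⟩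
        have h0 : 24 * t1 * t2 ≠ 0 := fun h => ht.2.1 (by rw [h, zero_mul])
        exact mul_left_cancel₀ h0 (ht.2.2.trans hs.2.2.symm)
    refine this.trans ?_
    rw [Finset.card_product, sq]
    exact Nat.mul_le_mul hle hle

lemma zero_card (I : Finset ℤ) :
    #{t ∈ I ×ˢ I ×ˢ I | ¬ 24 * t.1 * t.2.1 * t.2.2 ≠ 0} ≤ 3 * (#I * #I) := by
  have hsub : {t ∈ I ×ˢ I ×ˢ I | ¬ 24 * t.1 * t.2.1 * t.2.2 ≠ 0} ⊆
      (({0} : Finset ℤ) ×ˢ I ×ˢ I ∪ I ×ˢ ({0} : Finset ℤ) ×ˢ I) ∪ I ×ˢ I ×ˢ ({0} : Finset ℤ) := by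
    rintro ⟨t1, t2, t3⟩ ht
    simp only [mem_filter, mem_product, not_not, mul_eq_zero, mem_union, mem_singleton] at ht ⊢
    have : (24 : ℤ) ≠ 0 := by norm_num
    tauto
  refine (Finset.card_le_card hsub).trans ((Finset.card_union_le _ _).trans ?_)
  have := Finset.card_union_le (({0} : Finset ℤ) ×ˢ I ×ˢ I) (I ×ˢ ({0} : Finset ℤ) ×ˢ I)
  simp only [card_product, card_singleton] at *
  linarith

lemma case2 (N q : ℕ) (hN : 1 ≤ N) (hqN : N < q) (hq2 : q ≤ 384 * N ^ 3) (a : ℤ)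
    (ha : Int.gcd a q = 1) (W : ℝ) (hW0 : 0 ≤ W)
    (hW : ∀ n : ℕ, 0 < n → n ≤ 24 * N ^ 3 → (#n.divisors : ℝ) ≤ W) :
    ∑ h₁ ∈ Ioo (-(N : ℤ)) N, ∑ h₂ ∈ Ioo (-(N : ℤ)) N, ∑ h₃ ∈ Ioo (-(N : ℤ)) N,
        KK N q ((-a) * (24 * h₁ * h₂ * h₃) % q)
      ≤ 12 * N ^ 3 + 4 * W ^ 2 * (916 * N ^ 3 * (1 + Real.log q)) := by
  have hq : 0 < q := by omega
  set I := Ioo (-(N : ℤ)) N with hI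
  have hc : (#I : ℝ) ≤ 2 * N := card_Ioo_le N
  set F : ℤ → ℝ := fun m => KK N q ((-a) * m % q) with hF
  have hF0 : ∀ m, 0 ≤ F m := fun m => KK_nonneg _ (by positivity) _ _
    (Int.emod_nonneg _ (by omega)) (Int.emod_lt_of_pos _ (by omega))
  have hFz : F 0 = N := by simp [hF, KK]
  have hprod : ∑ h₁ ∈ I, ∑ h₂ ∈ I, ∑ h₃ ∈ I, KK N q ((-a) * (24 * h₁ * h₂ * h₃) % q)
      = ∑ t ∈ I ×ˢ I ×ˢ I, F (24 * t.1 * t.2.1 * t.2.2) := by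
    rw [Finset.sum_product]
    refine Finset.sum_congr rfl fun h₁ _ => ?_
    rw [Finset.sum_product]
  rw [hprod, ← Finset.sum_filter_add_sum_filter_not _ (fun t => 24 * t.1 * t.2.1 * t.2.2 ≠ 0), add_comm]
  have hNR : (1 : ℝ) ≤ N := by exact_mod_cast hN
  refine add_le_add ?_ ?_
  · calc ∑ t ∈ I ×ˢ I ×ˢ I with ¬ 24 * t.1 * t.2.1 * t.2.2 ≠ 0, F (24 * t.1 * t.2.1 * t.2.2)
        = ∑ t ∈ I ×ˢ I ×ˢ I with ¬ 24 * t.1 * t.2.1 * t.2.2 ≠ 0, (N : ℝ) := by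
          refine Finset.sum_congr rfl fun t ht => ?_
          rw [not_not.mp (mem_filter.mp ht).2, hFz]
      _ = (#{t ∈ I ×ˢ I ×ˢ I | ¬ 24 * t.1 * t.2.1 * t.2.2 ≠ 0} : ℝ) * N := by
          rw [Finset.sum_const, nsmul_eq_mul]
      _ ≤ (3 * (#I * #I) : ℝ) * N := by
          gcongr
          exact_mod_cast zero_card I
      _ ≤ (3 * ((2 * N) * (2 * N)) : ℝ) * N := by gcongr
      _ = 12 * N ^ 3 := by ring
  · set J := Ico (-(24 * N ^ 3 : ℤ)) (24 * N ^ 3 + 1) with hJ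
    have habs : ∀ h ∈ I, |h| ≤ N := by
      intro h hh
      rw [hI, mem_Ioo] at hh
      rw [abs_le]; omega
    have hmaps : ∀ t ∈ {t ∈ I ×ˢ I ×ˢ I | 24 * t.1 * t.2.1 * t.2.2 ≠ 0},
        24 * t.1 * t.2.1 * t.2.2 ∈ J := by
      intro t ht
      rw [mem_filter, mem_product, mem_product] at ht
      have : |24 * t.1 * t.2.1 * t.2.2| ≤ 24 * N ^ 3 := by
        rw [abs_mul, abs_mul, abs_mul, show |(24 : ℤ)| = 24 by norm_num]
        calc 24 * |t.1| * |t.2.1| * |t.2.2| ≤ 24 * N * N * N := by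
              gcongr
              exacts [habs _ ht.1.1, habs _ ht.1.2.1, habs _ ht.1.2.2]
          _ = _ := by ring
      rw [abs_le] at this
      rw [hJ, mem_Ico]
      exact ⟨this.1, by linarith [this.2]⟩
    rw [← Finset.sum_fiberwise_of_maps_to hmaps]
    have step : ∀ m ∈ J, ∑ t ∈ {t ∈ I ×ˢ I ×ˢ I | 24 * t.1 * t.2.1 * t.2.2 ≠ 0} with
        24 * t.1 * t.2.1 * t.2.2 = m, F (24 * t.1 * t.2.1 * t.2.2) ≤ 4 * W ^ 2 * F m := by
      intro m hm
      have e : ∑ t ∈ {t ∈ I ×ˢ I ×ˢ I | 24 * t.1 * t.2.1 * t.2.2 ≠ 0} with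
        24 * t.1 * t.2.1 * t.2.2 = m, F (24 * t.1 * t.2.1 * t.2.2)
          = (#{t ∈ I ×ˢ I ×ˢ I | 24 * t.1 * t.2.1 * t.2.2 ≠ 0 ∧ 24 * t.1 * t.2.1 * t.2.2 = m} : ℝ)
            * F m := by
        rw [Finset.filter_filter, ← nsmul_eq_mul, ← Finset.sum_const]
        refine Finset.sum_congr rfl fun t ht => ?_
        rw [(mem_filter.mp ht).2.2]
      rw [e]
      refine mul_le_mul_of_nonneg_right ?_ (hF0 m)
      have h1 : (#{t ∈ I ×ˢ I ×ˢ I | 24 * t.1 * t.2.1 * t.2.2 ≠ 0 ∧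
          24 * t.1 * t.2.1 * t.2.2 = m} : ℝ) ≤ (2 * (#(m.natAbs.divisors) : ℝ)) ^ 2 := by
        exact_mod_cast triple_card I m
      refine h1.trans ?_
      have h2 : (#(m.natAbs.divisors) : ℝ) ≤ W := by
        rcases Nat.eq_zero_or_pos m.natAbs with h | h
        · rw [h]; simpa using hW0
        · refine hW _ h ?_
          rw [hJ, mem_Ico] at hm
          zify
          rw [abs_le]
          exact ⟨hm.1, by linarith [hm.2]⟩
      calc (2 * (#(m.natAbs.divisors) : ℝ)) ^ 2 ≤ (2 * W) ^ 2 := by gcongr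
        _ = _ := by ring
    refine (Finset.sum_le_sum step).trans ?_
    rw [← Finset.mul_sum]
    refine mul_le_mul_of_nonneg_left ?_ (by positivity)
    have hneg : Int.gcd (-a) q = 1 := by rw [Int.neg_gcd]; exact ha
    refine (KK_sum N (by positivity) q hq (-a) hneg _ _ ?_).trans ?_
    · have : (0 : ℤ) ≤ N ^ 3 := by positivity
      linarith
    have hqR : (0 : ℝ) < q := by exact_mod_cast hq
    have hqNR : (N : ℝ) ≤ q := by exact_mod_cast hqN.le
    have hq2R : (q : ℝ) ≤ 384 * N ^ 3 := by exact_mod_cast hq2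
    have hlog0 : 0 ≤ Real.log q := Real.log_natCast_nonneg _
    set L := 1 + Real.log q with hL
    have hL1 : 1 ≤ L := by linarith
    have hN3 : (1 : ℝ) ≤ N ^ 3 := one_le_pow₀ hNR
    have hN13 : (N : ℝ) ≤ N ^ 3 := le_self_pow₀ hNR (by norm_num)
    push_cast
    calc ((24 * (N : ℝ) ^ 3 + 1 - -(24 * N ^ 3)) / q + 1) * (N + 2 * q * L)
        ≤ (49 * N ^ 3 / q + 1) * (N + 2 * q * L) := by
          gcongr; linarith
      _ = 49 * N ^ 3 * (N / q) + 98 * N ^ 3 * L + N + 2 * q * L := by field_simp; ring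
      _ ≤ 49 * N ^ 3 * 1 + 98 * N ^ 3 * L + N ^ 3 + 2 * (384 * N ^ 3) * L := by
          gcongr
          exact (div_le_one hqR).mpr hqNR
      _ ≤ 916 * N ^ 3 * L := by nlinarith

lemma weyl_final : ∃ D : ℝ, 0 < D ∧ ∀ (x α : ℝ) (a : ℤ) (q : ℕ), 3 ≤ x → 0 < q →
      Int.gcd a q = 1 → |α - (a : ℝ) / q| ≤ 1 / (48 * x ^ 3 * q) →
      (q : ℝ) ≤ 48 * x ^ 3 →
      ‖∑ n ∈ Finset.Icc 1 ⌊x⌋₊, ee (-(α * (n : ℝ) ^ 4))‖ ^ 8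
        ≤ D * x ^ 8 * (1 / (q : ℝ) ^ (1 / 2 : ℝ) + 1 / x ^ (1 / 8 : ℝ)) := by
  obtain ⟨C, hC1, hC⟩ := divisor_bound
  refine ⟨192000000 * C ^ 2, by positivity, ?_⟩
  intro x α a q hx hq ha hα hqx
  obtain ⟨N, hN⟩ : ∃ N, N = ⌊x⌋₊ := ⟨_, rfl⟩
  refine (weyl_main x α a q hx hq hα N hN).trans ?_
  have hN1 : 1 ≤ N := by
    rw [hN]; exact Nat.le_floor (by norm_num; linarith)
  have hNx : (N : ℝ) ≤ x := by rw [hN]; exact Nat.floor_le (by linarith)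
  have hxN : x ≤ 2 * N := by
    have h1 : x < N + 1 := by rw [hN]; exact Nat.lt_floor_add_one x
    have h2 : (1 : ℝ) ≤ N := by exact_mod_cast hN1
    linarith
  have hNR : (1 : ℝ) ≤ N := by exact_mod_cast hN1
  have hqR : (1 : ℝ) ≤ q := by exact_mod_cast hq
  have hC2 : 1 ≤ C ^ 2 := one_le_pow₀ hC1
  set y : ℝ := (N : ℝ) ^ (1 / 8 : ℝ) with hy
  set z : ℝ := (q : ℝ) ^ (1 / 8 : ℝ) with hz
  have hy1 : 1 ≤ y := Real.one_le_rpow hNR (by norm_num)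
  have hz1 : 1 ≤ z := Real.one_le_rpow hqR (by norm_num)
  have hy8 : (N : ℝ) = y ^ 8 := by
    rw [hy, ← Real.rpow_natCast, ← Real.rpow_mul (by linarith)]; norm_num
  have hz8 : (q : ℝ) = z ^ 8 := by
    rw [hz, ← Real.rpow_natCast, ← Real.rpow_mul (by linarith)]; norm_num
  have hz4 : (q : ℝ) ^ (1 / 2 : ℝ) = z ^ 4 := by
    rw [hz, ← Real.rpow_natCast, ← Real.rpow_mul (by linarith)]; norm_num
  have hxy : 1 / y ≤ 2 * (1 / x ^ (1 / 8 : ℝ)) := by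
    have h1 : x ^ (1 / 8 : ℝ) ≤ 2 * y := by
      calc x ^ (1 / 8 : ℝ) ≤ (2 * N) ^ (1 / 8 : ℝ) := by gcongr
        _ = 2 ^ (1 / 8 : ℝ) * y := Real.mul_rpow (by norm_num) (by linarith)
        _ ≤ 2 ^ (1 : ℝ) * y := by
            gcongr
            · norm_num
            · norm_num
        _ = 2 * y := by norm_num
    have h2 : 0 < x ^ (1 / 8 : ℝ) := by positivity
    rw [mul_one_div, div_le_div_iff₀ (by positivity) h2]
    linarith
  have hlogy : Real.log y ≤ y := (Real.log_le_sub_one_of_pos (by linarith)).trans (by linarith)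
  have hlogN : Real.log N = 8 * Real.log y := by rw [hy8, Real.log_pow]; norm_num
  have main : ∑ h₁ ∈ Ioo (-(N : ℤ)) N, ∑ h₂ ∈ Ioo (-(N : ℤ)) N, ∑ h₃ ∈ Ioo (-(N : ℤ)) N,
        KK N q ((-a) * (24 * h₁ * h₂ * h₃) % q) ≤ 6000000 * C ^ 2 * N ^ 4 * (1 / z ^ 4 + 1 / y) := by
    rcases le_or_gt q N with hle | hlt
    · refine (case1 N q hq hle a ha).trans ?_
      have hτ : (#q.divisors : ℝ) ≤ C * z := hC q hq
      calc 648 * (N : ℝ) ^ 4 * (#q.divisors : ℝ) ^ 2 / q + 24 * N ^ 3 * (1 + Real.log N)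
          ≤ 648 * (N : ℝ) ^ 4 * (C * z) ^ 2 / q + 24 * N ^ 3 * (9 * y) := by
            have j1 : (#q.divisors : ℝ) ^ 2 ≤ (C * z) ^ 2 := pow_le_pow_left₀ (Nat.cast_nonneg _) hτ 2
            have j2 : 1 + Real.log N ≤ 9 * y := by rw [hlogN]; linarith
            exact add_le_add (div_le_div_of_nonneg_right
              (mul_le_mul_of_nonneg_left j1 (by positivity)) (Nat.cast_nonneg _))
              (mul_le_mul_of_nonneg_left j2 (by positivity))
        _ = 648 * C ^ 2 * (N : ℝ) ^ 4 * (1 / z ^ 6) + 216 * N ^ 4 * (1 / y ^ 7) := by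
            rw [hz8, hy8]; field_simp; ring
        _ ≤ 6000000 * C ^ 2 * (N : ℝ) ^ 4 * (1 / z ^ 4) + 6000000 * C ^ 2 * N ^ 4 * (1 / y) := by
            have i1 : 1 / z ^ 6 ≤ 1 / z ^ 4 := by
              apply one_div_le_one_div_of_le (by positivity)
              exact pow_le_pow_right₀ hz1 (by norm_num)
            have i2 : 1 / y ^ 7 ≤ 1 / y := by
              apply one_div_le_one_div_of_le (by positivity)
              exact le_self_pow₀ hy1 (by norm_num)
            gcongr
            · norm_num
            · linarith
        _ = _ := by ring
    · have hq2 : (q : ℝ) ≤ 384 * N ^ 3 := by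
        calc (q : ℝ) ≤ 48 * x ^ 3 := hqx
          _ ≤ 48 * (2 * N) ^ 3 := by gcongr
          _ = _ := by ring
      have hq2' : q ≤ 384 * N ^ 3 := by exact_mod_cast hq2
      refine (case2 N q hN1 hlt hq2' a ha (2 * C * y ^ 3) (by positivity) ?_).trans ?_
      · intro n hn hn2
        refine (hC n hn).trans ?_
        have hn2' : (n : ℝ) ≤ (2 * y ^ 3) ^ 8 := by
          have : (n : ℝ) ≤ 24 * N ^ 3 := by exact_mod_cast hn2
          refine this.trans ?_
          rw [hy8]
          have : (0 : ℝ) ≤ (y ^ 3) ^ 8 := by positivity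
          nlinarith
        have : (n : ℝ) ^ (1 / 8 : ℝ) ≤ 2 * y ^ 3 := by
          calc (n : ℝ) ^ (1 / 8 : ℝ) ≤ ((2 * y ^ 3) ^ 8) ^ (1 / 8 : ℝ) := by gcongr
            _ = 2 * y ^ 3 := by
              rw [← Real.rpow_natCast, ← Real.rpow_mul (by positivity)]; norm_num
        nlinarith
      · have hL : 1 + Real.log q ≤ 408 * y := by
          have h1 : Real.log q ≤ Real.log (384 * N ^ 3) := Real.log_le_log (by linarith) hq2
          rw [Real.log_mul (by norm_num) (by positivity), Real.log_pow, hlogN] at h1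
          have h2 : Real.log 384 ≤ 384 - 1 := Real.log_le_sub_one_of_pos (by norm_num)
          push_cast at h1
          linarith
        calc 12 * (N : ℝ) ^ 3 + 4 * (2 * C * y ^ 3) ^ 2 * (916 * N ^ 3 * (1 + Real.log q))
            ≤ 12 * (N : ℝ) ^ 3 + 4 * (2 * C * y ^ 3) ^ 2 * (916 * N ^ 3 * (408 * y)) := by gcongr
          _ = 12 * N ^ 4 * (1 / y ^ 8) + 5979648 * C ^ 2 * N ^ 4 * (1 / y) := by
              rw [hy8]; field_simp; ring
          _ ≤ 12 * C ^ 2 * N ^ 4 * (1 / y) + 5979648 * C ^ 2 * N ^ 4 * (1 / y) := by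
              have i2 : 1 / y ^ 8 ≤ 1 / y := by
                apply one_div_le_one_div_of_le (by positivity)
                exact le_self_pow₀ hy1 (by norm_num)
              gcongr
              linarith
          _ = 5979660 * C ^ 2 * N ^ 4 * (1 / y) := by ring
          _ ≤ 6000000 * C ^ 2 * N ^ 4 * (1 / z ^ 4 + 1 / y) := by
              have : 0 ≤ 1 / z ^ 4 := by positivity
              gcongr
              · norm_num
              · linarith
  calc _ ≤ (2 * (N : ℝ)) ^ 4 * (6000000 * C ^ 2 * N ^ 4 * (1 / z ^ 4 + 1 / y)) := by gcongr
    _ = 96000000 * C ^ 2 * N ^ 8 * (1 / z ^ 4 + 1 / y) := by ring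
    _ ≤ 96000000 * C ^ 2 * x ^ 8 * (1 / z ^ 4 + 1 / y) := by gcongr
    _ ≤ 96000000 * C ^ 2 * x ^ 8 * (2 * (1 / z ^ 4) + 2 * (1 / x ^ (1 / 8 : ℝ))) := by
        have : 0 ≤ 1 / z ^ 4 := by positivity
        gcongr
        linarith
    _ = _ := by rw [hz4]; ring

theorem stmt16 (c₁ : ℝ) (hc₁ : 0 < c₁) :
    ∃ c₉ > (0:ℝ), ∃ C > 0, ∀ (x α : ℝ) (a : ℤ) (q : ℕ), 3 ≤ x →
      Int.gcd a q = 1 → |α - (a : ℝ) / q| ≤ 1 / (48 * x ^ 3 * q) →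
      Real.log x ^ c₁ < (q : ℝ) → (q : ℝ) ≤ 48 * x ^ 3 →
      ‖∑ n ∈ Finset.Icc 1 ⌊x⌋₊, ee (-(α * (n : ℝ) ^ 4))‖ ≤ C * x * Real.log x ^ (-c₉) := by
  obtain ⟨D, hD, hmain⟩ := weyl_final
  set ε : ℝ := 1 / (4 * c₁) with hε
  have hε0 : 0 < ε := by positivity
  set K : ℝ := (1 / ε) ^ (c₁ / 2) with hK
  have hK0 : 0 < K := by positivity
  refine ⟨c₁ / 16, by positivity, (D * (1 + K)) ^ (1 / 8 : ℝ), by positivity, ?_⟩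
  intro x α a q hx ha hα hq1 hq2
  have hl : 0 < Real.log x := Real.log_pos (by linarith)
  have hq0 : 0 < q := by
    have : (0 : ℝ) < q := lt_of_le_of_lt (by positivity) hq1
    exact_mod_cast this
  have hx0 : (0 : ℝ) < x := by linarith
  have h := hmain x α a q hx hq0 ha hα hq2
  have i1 : 1 / (q : ℝ) ^ (1 / 2 : ℝ) ≤ 1 / Real.log x ^ (c₁ / 2) := by
    apply one_div_le_one_div_of_le (by positivity)
    calc Real.log x ^ (c₁ / 2) = (Real.log x ^ c₁) ^ (1 / 2 : ℝ) := by
          rw [← Real.rpow_mul hl.le]; congr 1; ring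
      _ ≤ _ := by gcongr
  have i2 : 1 / x ^ (1 / 8 : ℝ) ≤ K * (1 / Real.log x ^ (c₁ / 2)) := by
    have h1 : Real.log x ≤ x ^ ε / ε := Real.log_le_rpow_div hx0.le hε0
    have h2 : Real.log x ^ (c₁ / 2) ≤ K * x ^ (1 / 8 : ℝ) := by
      calc Real.log x ^ (c₁ / 2) ≤ (x ^ ε / ε) ^ (c₁ / 2) := by gcongr
        _ = (1 / ε * x ^ ε) ^ (c₁ / 2) := by congr 1; ring
        _ = K * (x ^ ε) ^ (c₁ / 2) := Real.mul_rpow (by positivity) (by positivity)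
        _ = K * x ^ (1 / 8 : ℝ) := by
            rw [← Real.rpow_mul hx0.le]
            congr 2
            rw [hε]; field_simp; norm_num
    rw [mul_one_div, div_le_div_iff₀ (by positivity) (by positivity)]
    linarith
  refine le_of_pow_le_pow_left₀ (n := 8) (by norm_num) (by positivity) ?_
  have e1 : ((D * (1 + K)) ^ (1 / 8 : ℝ)) ^ 8 = D * (1 + K) := by
    rw [← Real.rpow_natCast, ← Real.rpow_mul (by positivity)]; norm_num
  have e2 : (Real.log x ^ (-(c₁ / 16))) ^ 8 = 1 / Real.log x ^ (c₁ / 2) := by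
    rw [← Real.rpow_natCast, ← Real.rpow_mul hl.le, one_div, ← Real.rpow_neg hl.le]
    congr 1; push_cast; ring
  rw [mul_pow, mul_pow, e1, e2]
  calc _ ≤ _ := h
    _ ≤ D * x ^ 8 * (1 / Real.log x ^ (c₁ / 2) + K * (1 / Real.log x ^ (c₁ / 2))) := by gcongr
    _ = _ := by ring
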